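/- arXiv:1409.3426 — 2 statements merged into one kernel-verified Lean document; each statement's English description precedes it below -/
import Mathlib

section
/- Let A and B be nonempty finite types and let P be a projection on ℂ^(A×B) that supports a quantum channel. Then Σ(P) = sup { Re(trace S) : S a Hermitian A×A matrix such that there exists a positive semidefinite (A×B)-indexed matrix E with Tr_A(E) = 1_B and P·(S ⊗ 1_B − E)·P ≤ 0 }. (Strong duality between the primal and dual SDP for the one-shot no-signalling assisted simulation cost.) -/
open Matrix Kronecker BigOperators
open scoped ComplexOrder

noncomputable section

/-- Loewner order: `M ≤ N` iff `N - M` is positive semidefinite. -/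
def loe {n : Type*} [Fintype n] (M N : Matrix n n ℂ) : Prop := (N - M).PosSemidef

/-- A projection: Hermitian and idempotent. -/
def IsProj {n : Type*} [Fintype n] (M : Matrix n n ℂ) : Prop := M.IsHermitian ∧ M * M = M

variable {A B : Type*} [Fintype A] [Fintype B] [DecidableEq A] [DecidableEq B]

/-- Partial trace over `A`. -/
def trA (M : Matrix (A × B) (A × B) ℂ) : Matrix B B ℂ :=
  Matrix.of fun b b' => ∑ a, M (a, b) (a, b')

/-- Partial trace over `B`. -/
def trB (M : Matrix (A × B) (A × B) ℂ) : Matrix A A ℂ :=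
  Matrix.of fun a a' => ∑ b, M (a, b) (a', b)

/-- `P` supports a quantum channel: there is a PSD `J` supported on `P` with `Tr_B J = 1`. -/
def SupportsChannel (P : Matrix (A × B) (A × B) ℂ) : Prop :=
  ∃ J : Matrix (A × B) (A × B) ℂ, J.PosSemidef ∧ P * J = J ∧ trB J = 1

/-- One-shot no-signalling assisted simulation cost (primal SDP). -/
def SigmaNS (P : Matrix (A × B) (A × B) ℂ) : ℝ :=
  sInf { x : ℝ | ∃ T : Matrix B B ℂ, T.IsHermitian ∧ x = T.trace.re ∧
    ∃ F : Matrix (A × B) (A × B) ℂ,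
      loe 0 F ∧ loe F ((1 : Matrix A A ℂ) ⊗ₖ T) ∧ trB F = 1 ∧
      ((1 - P) * F).trace = 0 }

set_option linter.unusedSectionVars false

theorem lagrange_aux {X Y : Type*} [AddCommGroup X] [Module ℝ X]
    [TopologicalSpace Y] [AddCommGroup Y] [Module ℝ Y] [IsTopologicalAddGroup Y]
    [ContinuousSMul ℝ Y] (K : Set Y) (hopen : IsOpen K) (hconv : Convex ℝ K)
    (hcone : ∀ k ∈ K, ∀ s : ℝ, 0 < s → s • k ∈ K)
    (f : X →ₗ[ℝ] ℝ) (L : X →ₗ[ℝ] Y) (y0 : Y) (x0 : X) (hx0 : y0 + L x0 ∈ K)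
    (d : ℝ) (hd : ∀ x, y0 + L x ∈ K → f x ≤ d) :
    ∃ φ : Y →ₗ[ℝ] ℝ, (∀ k ∈ K, 0 ≤ φ k) ∧ ∀ x, f x + φ (y0 + L x) ≤ d := by
  let U : Set (Y × ℝ) := {p | ∃ x, y0 + L x - p.1 ∈ K ∧ p.2 < f x}
  have hUo : IsOpen U := by
    have : U = ⋃ x, {p : Y × ℝ | y0 + L x - p.1 ∈ K ∧ p.2 < f x} := by
      ext p; simp [U]
    rw [this]
    refine isOpen_iUnion fun x => IsOpen.inter ?_ ?_
    · exact hopen.preimage (by fun_prop)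
    · exact isOpen_lt continuous_snd continuous_const
  have hUc : Convex ℝ U := by
    rintro ⟨y, t⟩ ⟨x, h1, h2⟩ ⟨y', t'⟩ ⟨x', h1', h2'⟩ a b ha hb hab
    refine ⟨a • x + b • x', ?_, ?_⟩
    · have := hconv h1 h1' ha hb hab
      convert this using 1
      have hy : y0 = a • y0 + b • y0 := by rw [← add_smul, hab, one_smul]
      simp only [map_add, map_smul, Prod.fst_add, Prod.smul_fst]
      nth_rewrite 1 [hy]
      module
    · simp only [map_add, map_smul, smul_eq_mul, Prod.snd_add, Prod.smul_snd] at *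
      rcases eq_or_lt_of_le ha with h | h
      · have : b = 1 := by linarith
        subst this; subst h; simpa using h2'
      · nlinarith [mul_lt_mul_of_pos_left h2 h, mul_le_mul_of_nonneg_left h2'.le hb]
  have hn : ((0 : Y), d) ∉ U := by
    rintro ⟨x, h1, h2⟩
    have := hd x (by simpa using h1)
    simp at h2; linarith
  obtain ⟨φ, hφ⟩ := geometric_hahn_banach_open_point hUc hUo hn
  let ψ : Y →ₗ[ℝ] ℝ := φ.toLinearMap ∘ₗ LinearMap.inl ℝ Y ℝ
  let τ : ℝ := φ (0, 1)
  have hdec : ∀ y t, φ (y, t) = ψ y + t * τ := by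
    intro y t
    have : ((y, t) : Y × ℝ) = (y, 0) + t • (0, 1) := by simp
    rw [this, map_add, map_smul]; rfl
  have key : ∀ x, ∀ k ∈ K, ∀ s e : ℝ, 0 < s → 0 < e →
      ψ (y0 + L x) - s * ψ k + (f x - e) * τ < d * τ := by
    intro x k hk s e hs he
    have := hφ (y0 + L x - s • k, f x - e) ⟨x, by simpa using hcone k hk s hs, by simpa using he⟩
    rw [hdec, hdec] at this
    simpa using this
  have hτ : 0 < τ := by
    have h := key x0 _ hx0 1 1 one_pos one_pos
    have h' := hd x0 hx0
    by_contra hc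
    push Not at hc
    nlinarith
  have hpos : ∀ k ∈ K, 0 ≤ ψ k := by
    intro k hk
    by_contra hc
    push Not at hc
    set c := ψ (y0 + L x0) + (f x0 - 1) * τ - d * τ with hcdef
    have h := key x0 k hk ((|c| + 1) / (-ψ k)) 1 (div_pos (by positivity) (by linarith)) one_pos
    have e : (|c| + 1) / (-ψ k) * ψ k = -(|c| + 1) := by
      rw [div_neg, neg_mul, div_mul_cancel₀ _ hc.ne]
    rw [e] at h
    have := neg_abs_le c
    linarith
  refine ⟨τ⁻¹ • ψ, fun k hk => ?_, fun x => ?_⟩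
  · simpa using mul_nonneg (inv_nonneg.2 hτ.le) (hpos k hk)
  · have main : ψ (y0 + L x) + f x * τ ≤ d * τ := by
      by_contra hc
      push Not at hc
      set δ := ψ (y0 + L x) + f x * τ - d * τ with hδ
      have hδ0 : 0 < δ := by linarith
      have hk := hpos _ hx0
      set q := ψ (y0 + L x0)
      have h := key x _ hx0 (δ / (2 * (q + 1))) (δ / (2 * τ)) (by positivity) (by positivity)
      have e1 : δ / (2 * τ) * τ = δ / 2 := by field_simp
      have e2 : δ / (2 * (q + 1)) * q ≤ δ / 2 := by
        rw [div_mul_eq_mul_div, div_le_div_iff₀ (by positivity) (by positivity)]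
        nlinarith
      have : ψ (y0 + L x0) = q := rfl
      rw [this, sub_mul, e1] at h
      linarith
    have : (τ⁻¹ • ψ) (y0 + L x) = τ⁻¹ * ψ (y0 + L x) := rfl
    rw [this]
    have h2 := mul_le_mul_of_nonneg_left main (inv_nonneg.2 hτ.le)
    have e : τ⁻¹ * (ψ (y0 + L x) + f x * τ) = f x + τ⁻¹ * ψ (y0 + L x) := by
      field_simp; ring
    have e' : τ⁻¹ * (d * τ) = d := by field_simp
    linarith

section mats
variable {n : Type*} [Fintype n] [DecidableEq n]

def qf (M : Matrix n n ℂ) (v : n → ℂ) : ℝ := (star v ⬝ᵥ (M *ᵥ v)).re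

def KK (n : Type*) [Fintype n] : Set (Matrix n n ℂ) :=
  {M | ∀ v ∈ Metric.sphere (0 : n → ℂ) 1, 0 < qf M v}

theorem qf_add (M N : Matrix n n ℂ) (v) : qf (M + N) v = qf M v + qf N v := by
  simp [qf, add_mulVec]

theorem qf_smul (s : ℝ) (M : Matrix n n ℂ) (v) : qf (s • M) v = s * qf M v := by
  simp [qf, smul_mulVec]

theorem qf_conj (M : Matrix n n ℂ) (v) : qf Mᴴ v = qf M v := by
  unfold qf
  have : star v ⬝ᵥ (Mᴴ *ᵥ v) = star (star v ⬝ᵥ (M *ᵥ v)) := by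
    rw [← star_dotProduct_star, star_star, star_mulVec, ← dotProduct_mulVec]
  rw [this]; simp

theorem KK_open : IsOpen (KK n) := by
  rw [isOpen_iff_mem_nhds]
  intro M hM
  refine IsCompact.eventually_forall_of_forall_eventually (isCompact_sphere (0 : n → ℂ) 1)
    (P := fun M v => 0 < qf M v) fun v hv => ?_
  have hc : Continuous fun z : Matrix n n ℂ × (n → ℂ) => qf z.1 z.2 := by
    unfold qf
    refine Complex.continuous_re.comp ?_
    fun_prop
  exact hc.continuousAt.eventually (lt_mem_nhds (hM v hv))

theorem KK_convex : Convex ℝ (KK n) := by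
  intro M hM N hN a b ha hb hab v hv
  have h1 := hM v hv
  have h2 := hN v hv
  rw [qf_add, qf_smul, qf_smul]
  rcases eq_or_lt_of_le ha with h | h
  · have : b = 1 := by linarith
    subst this; subst h; simpa using h2
  · nlinarith [mul_pos h h1, mul_nonneg hb h2.le]

theorem KK_cone : ∀ k ∈ KK n, ∀ s : ℝ, 0 < s → s • k ∈ KK n := by
  intro k hk s hs v hv
  rw [qf_smul]; exact mul_pos hs (hk v hv)

theorem KK_of_posDef {M : Matrix n n ℂ} (h : M.PosDef) : M ∈ KK n := by
  intro v hv
  have hv0 : v ≠ 0 := by rintro rfl; simp at hv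
  exact (Complex.pos_iff.1 (h.dotProduct_mulVec_pos hv0)).1

theorem qf_nonneg_of_KK {M : Matrix n n ℂ} (h : M ∈ KK n) (v : n → ℂ) : 0 ≤ qf M v := by
  by_cases hv : v = 0
  · simp [qf, hv]
  have hn : ‖v‖ ≠ 0 := norm_ne_zero_iff.2 hv
  have h1 := h ((‖v‖⁻¹ : ℝ) • v) (by simp [norm_smul, hn])
  have : qf M v = ‖v‖ ^ 2 * qf M ((‖v‖⁻¹ : ℝ) • v) := by
    simp [qf, mulVec_smul]
    field_simp
  rw [this]; positivity

def hp (M : Matrix n n ℂ) : Matrix n n ℂ := (2⁻¹ : ℝ) • (M + Mᴴ)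

theorem hp_herm (M : Matrix n n ℂ) : (hp M).IsHermitian := by
  simp [hp, IsHermitian, conjTranspose_smul, add_comm]

theorem hp_of_herm {M : Matrix n n ℂ} (h : M.IsHermitian) : hp M = M := by
  rw [hp, h.eq, ← two_smul ℝ, smul_smul]; simp

theorem hp_psd {M : Matrix n n ℂ} (h : M ∈ KK n) : (hp M).PosSemidef := by
  refine PosSemidef.of_dotProduct_mulVec_nonneg (hp_herm M) fun v => ?_
  rw [Complex.nonneg_iff]
  constructor
  · have : 0 ≤ qf (hp M) v := by
      rw [hp, qf_smul, qf_add, qf_conj]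
      have := qf_nonneg_of_KK h v
      linarith
    exact this
  · exact ((hp_herm M).im_star_dotProduct_mulVec_self v).symm

open scoped MatrixOrder in
theorem psd_sqrt {M : Matrix n n ℂ} (hM : M.PosSemidef) : ∃ C : Matrix n n ℂ, M = Cᴴ * C :=
  CStarAlgebra.nonneg_iff_eq_star_mul_self.1 hM.nonneg

theorem trace_mul_psd {M N : Matrix n n ℂ} (hM : M.PosSemidef) (hN : N.PosSemidef) :
    0 ≤ (M * N).trace.re := by
  obtain ⟨C, rfl⟩ := psd_sqrt hM
  rw [mul_assoc, trace_mul_comm]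
  exact (Complex.nonneg_iff.1 (hN.mul_mul_conjTranspose_same C).trace_nonneg).1

theorem nondeg {M : Matrix n n ℂ} (h : ∀ N : Matrix n n ℂ, (M * N).trace.re = 0) : M = 0 := by
  rw [← trace_mul_conjTranspose_self_eq_zero_iff]
  have h1 := (Complex.nonneg_iff.1 (posSemidef_self_mul_conjTranspose M).trace_nonneg).2
  exact Complex.ext (h _) h1.symm

theorem supp {P F : Matrix n n ℂ} (hP : IsProj P) (hF : F.PosSemidef)
    (h : ((1 - P) * F).trace = 0) : P * F = F ∧ F * P = F := by
  obtain ⟨C, rfl⟩ := psd_sqrt hF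
  have hQ : (1 - P)ᴴ = 1 - P := by simp [hP.1.eq]
  have hQ2 : (1 - P) * (1 - P) = 1 - P := by simp [mul_sub, sub_mul, hP.2]
  have h1 : C * (1 - P) = 0 := by
    rw [← trace_mul_conjTranspose_self_eq_zero_iff, conjTranspose_mul, hQ, ← mul_assoc,
      mul_assoc C, hQ2, ← h, mul_assoc, trace_mul_comm, mul_assoc]
  have h2 : C * P = C := by
    rw [mul_sub, mul_one, sub_eq_zero] at h1; exact h1.symm
  have h3 : P * Cᴴ = Cᴴ := by
    have := congrArg conjTranspose h2
    rwa [conjTranspose_mul, hP.1.eq] at this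
  exact ⟨by rw [← mul_assoc, h3], by rw [mul_assoc, h2]⟩

theorem repr_lin (φ : Matrix n n ℂ →ₗ[ℝ] ℝ) :
    ∃ Λ : Matrix n n ℂ, ∀ M, φ M = (Λ * M).trace.re := by
  refine ⟨Matrix.of fun j i => (φ (single i j 1) : ℂ) - Complex.I * φ (single i j Complex.I), ?_⟩
  intro M
  conv_lhs => rw [matrix_eq_sum_single M]
  have : ∀ i j, φ (single i j (M i j)) =
      (M i j).re * φ (single i j 1) + (M i j).im * φ (single i j Complex.I) := by
    intro i j
    rw [← smul_eq_mul, ← smul_eq_mul, ← map_smul, ← map_smul, ← map_add]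
    congr 1
    rw [smul_single, smul_single, ← single_add]
    congr 1
    apply Complex.ext <;> simp
  simp only [map_sum, this, trace, diag, mul_apply, of_apply, Complex.re_sum]
  rw [Finset.sum_comm]
  refine Finset.sum_congr rfl fun i _ => Finset.sum_congr rfl fun j _ => ?_
  simp
  ring

theorem psd_of_KK {Λ : Matrix n n ℂ} (h : ∀ k ∈ KK n, 0 ≤ (Λ * k).trace.re) : Λ.PosSemidef := by
  have h0 : ∀ M : Matrix n n ℂ, (∀ v, 0 ≤ qf M v) → 0 ≤ (Λ * M).trace.re := by
    intro M hM
    by_contra hc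
    push Not at hc
    set q := (Λ * 1).trace.re with hq
    have hq0 : 0 ≤ q := h 1 (KK_of_posDef PosDef.one)
    have := h (M + (-(Λ * M).trace.re / (2 * (q + 1))) • (1 : Matrix n n ℂ)) (by
      intro v hv
      rw [qf_add, qf_smul]
      have h1 := KK_of_posDef (PosDef.one : (1 : Matrix n n ℂ).PosDef) v hv
      have h2 : 0 < -(Λ * M).trace.re / (2 * (q + 1)) := div_pos (by linarith) (by positivity)
      have := mul_pos h2 h1
      linarith [hM v])
    rw [mul_add, mul_smul_comm, trace_add, trace_smul, Complex.add_re, Complex.smul_re, ← hq,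
      smul_eq_mul, div_mul_eq_mul_div] at this
    have h3 : -(Λ * M).trace.re * q / (2 * (q + 1)) ≤ -(Λ * M).trace.re / 2 := by
      rw [div_le_div_iff₀ (by positivity) (by positivity)]
      nlinarith
    linarith
  have hherm : Λ.IsHermitian := by
    have : Λ - Λᴴ = 0 := by
      apply nondeg
      intro M
      have h1 := h0 (M - Mᴴ) (fun v => by
        have := qf_add (M - Mᴴ) Mᴴ v
        rw [sub_add_cancel, qf_conj] at this; linarith)
      have h2 := h0 (Mᴴ - M) (fun v => by
        have := qf_add (Mᴴ - M) M v
        rw [sub_add_cancel, qf_conj] at this; linarith)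
      have h3 : (Λ * Mᴴ).trace.re = (Λᴴ * M).trace.re := by
        have : (Λ * Mᴴ) = (M * Λᴴ)ᴴ := by simp
        rw [this, trace_conjTranspose, trace_mul_comm]; simp
      simp only [mul_sub, sub_mul, trace_sub, Complex.sub_re] at *
      linarith
    exact (sub_eq_zero.1 this).symm
  refine PosSemidef.of_dotProduct_mulVec_nonneg hherm fun v => ?_
  rw [Complex.nonneg_iff]
  refine ⟨?_, (hherm.im_star_dotProduct_mulVec_self v).symm⟩
  have := h0 (vecMulVec v (star v)) (fun w =>
    (Complex.nonneg_iff.1 ((posSemidef_vecMulVec_self_star v).dotProduct_mulVec_nonneg w)).1)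
  rwa [mul_vecMulVec, trace_vecMulVec, dotProduct_comm] at this

end mats


theorem trace_trA (T : Matrix B B ℂ) (E : Matrix (A × B) (A × B) ℂ) :
    (((1 : Matrix A A ℂ) ⊗ₖ T) * E).trace = (T * trA E).trace := by
  simp only [trace, diag, mul_apply, trA, of_apply, kroneckerMap_apply, Fintype.sum_prod_type,
    one_apply, ite_mul, one_mul, zero_mul, Finset.mul_sum]
  simp only [Finset.sum_ite_irrel, Finset.sum_const_zero, Finset.sum_ite_eq, Finset.mem_univ,
    if_true]
  rw [Finset.sum_comm]
  exact Finset.sum_congr rfl fun _ _ => Finset.sum_comm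

theorem trace_trB (F : Matrix (A × B) (A × B) ℂ) (S : Matrix A A ℂ) :
    (F * (S ⊗ₖ (1 : Matrix B B ℂ))).trace = (trB F * S).trace := by
  simp only [trace, diag, mul_apply, trB, of_apply, kroneckerMap_apply, Fintype.sum_prod_type,
    one_apply, mul_ite, mul_one, mul_zero, Finset.sum_mul]
  simp only [Finset.sum_ite_eq', Finset.mem_univ, if_true]
  exact Finset.sum_congr rfl fun _ _ => Finset.sum_comm

theorem weak_dual {P : Matrix (A × B) (A × B) ℂ} (hP : IsProj P)
    {T : Matrix B B ℂ} {F : Matrix (A × B) (A × B) ℂ} (hF : loe 0 F)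
    (hFT : loe F ((1 : Matrix A A ℂ) ⊗ₖ T)) (hF1 : trB F = 1)
    (hPF : ((1 - P) * F).trace = 0)
    {S : Matrix A A ℂ} {E : Matrix (A × B) (A × B) ℂ} (hE : E.PosSemidef) (hE1 : trA E = 1)
    (hS : loe (P * (S ⊗ₖ (1 : Matrix B B ℂ) - E) * P) 0) : S.trace.re ≤ T.trace.re := by
  simp only [loe, sub_zero] at hF
  obtain ⟨h1, h2⟩ := supp hP hF hPF
  have a := trace_mul_psd hF hS
  have b := trace_mul_psd hFT hE
  have e : (F * (0 - P * (S ⊗ₖ (1 : Matrix B B ℂ) - E) * P)).trace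
      = (F * E).trace - S.trace := by
    have : (F * (P * (S ⊗ₖ (1 : Matrix B B ℂ) - E) * P)).trace
        = (F * (S ⊗ₖ (1 : Matrix B B ℂ) - E)).trace := by
      rw [trace_mul_comm, mul_assoc, h1, trace_mul_comm, ← mul_assoc, h2]
    rw [zero_sub, mul_neg, trace_neg, this, mul_sub, trace_sub, trace_trB, hF1, one_mul]
    ring
  rw [e, Complex.sub_re] at a
  rw [sub_mul, trace_sub, trace_trA, hE1, mul_one, Complex.sub_re] at b
  linarith

theorem primal_feas [Nonempty A] [Nonempty B] {P : Matrix (A × B) (A × B) ℂ} (hP : IsProj P)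
    (hch : SupportsChannel P) : ∃ T : Matrix B B ℂ, T.IsHermitian ∧
    ∃ F : Matrix (A × B) (A × B) ℂ,
      loe 0 F ∧ loe F ((1 : Matrix A A ℂ) ⊗ₖ T) ∧ trB F = 1 ∧
      ((1 - P) * F).trace = 0 := by
  obtain ⟨J, hJ, hPJ, hJ1⟩ := hch
  have h1 : ∀ᶠ ε : ℝ in nhds 0, (1 : Matrix (A × B) (A × B) ℂ) - ε • J ∈ KK (A × B) := by
    have hc : Continuous fun ε : ℝ => (1 : Matrix (A × B) (A × B) ℂ) - ε • J := by fun_prop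
    refine hc.continuousAt.eventually (KK_open.mem_nhds ?_)
    simpa using KK_of_posDef PosDef.one
  obtain ⟨ε, h2, hε⟩ := ((h1.filter_mono nhdsWithin_le_nhds).and
    (self_mem_nhdsWithin : Set.Ioi (0 : ℝ) ∈ nhdsWithin 0 (Set.Ioi 0))).exists
  have hε : 0 < ε := hε
  have h3 := hp_psd h2
  rw [hp_of_herm (by
    simp [IsHermitian, conjTranspose_smul, hJ.1.eq])] at h3
  refine ⟨(ε⁻¹ : ℝ) • 1, by simp [IsHermitian, conjTranspose_smul], J, by simpa [loe] using hJ, ?_,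
    hJ1, by simp [sub_mul, hPJ]⟩
  have h4 := h3.smul (inv_nonneg.2 hε.le)
  rw [smul_sub, smul_smul, inv_mul_cancel₀ hε.ne', one_smul] at h4
  rwa [loe, kronecker_smul, one_kronecker_one]

theorem trA_add (M N : Matrix (A × B) (A × B) ℂ) : trA (M + N) = trA M + trA N := by
  ext; simp [trA, Finset.sum_add_distrib]

theorem trA_smul (s : ℝ) (M : Matrix (A × B) (A × B) ℂ) : trA (s • M) = s • trA M := by
  ext; simp [trA, Finset.mul_sum]

theorem trA_hp (M : Matrix (A × B) (A × B) ℂ) : trA (hp M) = hp (trA M) := by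
  rw [hp, hp, trA_smul, trA_add]
  congr 2
  ext; simp [trA]

theorem trA_kron (R : Matrix B B ℂ) :
    trA ((1 : Matrix A A ℂ) ⊗ₖ R) = (Fintype.card A : ℝ) • R := by
  ext; simp [trA]

theorem hp_add {n : Type*} (M N : Matrix n n ℂ) : hp (M + N) = hp M + hp N := by
  simp only [hp, conjTranspose_add]; module

theorem hp_sub {n : Type*} (M N : Matrix n n ℂ) : hp (M - N) = hp M - hp N := by
  simp only [hp, conjTranspose_sub]; module

theorem hp_conj {n : Type*} [Fintype n] {P : Matrix n n ℂ} (hP : P.IsHermitian)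
    (M : Matrix n n ℂ) : hp (P * M * P) = P * hp M * P := by
  simp [hp, conjTranspose_mul, hP.eq, mul_add, add_mul, mul_assoc]

theorem hp_kron (S : Matrix A A ℂ) :
    hp (S ⊗ₖ (1 : Matrix B B ℂ)) = hp S ⊗ₖ (1 : Matrix B B ℂ) := by
  simp [hp, conjTranspose_kronecker, smul_kronecker, add_kronecker]

theorem hp_trace {n : Type*} [Fintype n] (M : Matrix n n ℂ) :
    (hp M).trace.re = M.trace.re := by
  simp [hp, trace_smul, trace_add, trace_conjTranspose]; ring

theorem dual_of_strict [Nonempty A] {P : Matrix (A × B) (A × B) ℂ} (hP : IsProj P)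
    (S : Matrix A A ℂ) (E : Matrix (A × B) (A × B) ℂ) (h1 : E ∈ KK (A × B))
    (h2 : 1 - trA E ∈ KK B)
    (h3 : (1 - P) + P * (E - S ⊗ₖ (1 : Matrix B B ℂ)) * P ∈ KK (A × B)) :
    ∃ S' : Matrix A A ℂ, S'.IsHermitian ∧ S.trace.re = S'.trace.re ∧
      ∃ E : Matrix (A × B) (A × B) ℂ, E.PosSemidef ∧ trA E = 1 ∧
        loe (P * (S' ⊗ₖ (1 : Matrix B B ℂ) - E) * P) 0 := by
  have g1 := hp_psd h1
  have g2 := hp_psd h2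
  have g3 := hp_psd h3
  rw [hp_sub, hp_of_herm isHermitian_one, ← trA_hp] at g2
  rw [hp_add, hp_of_herm (isHermitian_one.sub hP.1), hp_conj hP.1, hp_sub, hp_kron] at g3
  have g4 := g3.mul_mul_conjTranspose_same P
  set R := 1 - trA (hp E) with hR
  have hk : ((Fintype.card A : ℝ)⁻¹ • ((1 : Matrix A A ℂ) ⊗ₖ R)).PosSemidef :=
    (PosSemidef.one.kronecker g2).smul (by positivity)
  refine ⟨hp S, hp_herm S, (hp_trace S).symm, hp E + (Fintype.card A : ℝ)⁻¹ • (1 ⊗ₖ R),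
    g1.add hk, ?_, ?_⟩
  · rw [trA_add, trA_smul, trA_kron, smul_smul, inv_mul_cancel₀ (by simp), one_smul, hR]
    abel
  · have g5 := g4.add (hk.mul_mul_conjTranspose_same P)
    rw [loe]
    convert g5 using 1
    have e1 : P * (1 - P) = 0 := by simp [mul_sub, hP.2]
    have e2 : ∀ X, P * (P * X * P) * P = P * X * P := by
      intro X
      rw [← mul_assoc, ← mul_assoc, hP.2, mul_assoc, hP.2]
    rw [hP.1.eq, mul_add, e1, zero_add, e2]
    simp only [mul_sub, sub_mul, mul_add, add_mul]
    abel

theorem strong_exists [Nonempty A] {P : Matrix (A × B) (A × B) ℂ} (hP : IsProj P) (d : ℝ)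
    (hd : ∀ (S : Matrix A A ℂ) (E : Matrix (A × B) (A × B) ℂ), S.IsHermitian → E.PosSemidef →
      trA E = 1 → loe (P * (S ⊗ₖ (1 : Matrix B B ℂ) - E) * P) 0 → S.trace.re ≤ d) :
    ∃ T : Matrix B B ℂ, T.IsHermitian ∧ T.trace.re ≤ d ∧
    ∃ F : Matrix (A × B) (A × B) ℂ,
      loe 0 F ∧ loe F ((1 : Matrix A A ℂ) ⊗ₖ T) ∧ trB F = 1 ∧
      ((1 - P) * F).trace = 0 := by
  let f : (Matrix A A ℂ × Matrix (A × B) (A × B) ℂ) →ₗ[ℝ] ℝ :=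
    { toFun := fun p => p.1.trace.re
      map_add' := by simp
      map_smul' := by simp [trace_smul] }
  let L : (Matrix A A ℂ × Matrix (A × B) (A × B) ℂ) →ₗ[ℝ]
      (Matrix (A × B) (A × B) ℂ × Matrix B B ℂ × Matrix (A × B) (A × B) ℂ) :=
    { toFun := fun p => (p.2, - trA p.2, P * (p.2 - p.1 ⊗ₖ (1 : Matrix B B ℂ)) * P)
      map_add' := by
        intro p q
        refine Prod.ext rfl (Prod.ext ?_ ?_)
        · simp [trA_add, add_comm]
        · simp [add_kronecker, mul_sub, sub_mul, mul_add, add_mul]; abel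
      map_smul' := by
        intro s p
        refine Prod.ext rfl (Prod.ext ?_ ?_)
        · simp [trA_smul]
        · simp [smul_kronecker, mul_sub, sub_mul, smul_sub] }
  let K : Set (Matrix (A × B) (A × B) ℂ × Matrix B B ℂ × Matrix (A × B) (A × B) ℂ) :=
    KK (A × B) ×ˢ KK B ×ˢ KK (A × B)
  have hc1 : (1 : Matrix (A × B) (A × B) ℂ) ∈ KK (A × B) := KK_of_posDef PosDef.one
  have hc2 : (1 : Matrix B B ℂ) ∈ KK B := KK_of_posDef PosDef.one
  have hPpsd : P.PosSemidef := by
    have := posSemidef_self_mul_conjTranspose P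
    rwa [hP.1.eq, hP.2] at this
  obtain ⟨φ, hφK, hφ⟩ := lagrange_aux K (KK_open.prod (KK_open.prod KK_open))
    (KK_convex.prod (KK_convex.prod KK_convex))
    (by
      rintro ⟨k1, k2, k3⟩ ⟨h1, h2, h3⟩ s hs
      exact ⟨KK_cone _ h1 s hs, KK_cone _ h2 s hs, KK_cone _ h3 s hs⟩)
    f L (0, 1, 1 - P) (-1, ((2 * Fintype.card A : ℝ)⁻¹) • 1)
    (by
      have hc : (0 : ℝ) < (2 * Fintype.card A : ℝ)⁻¹ := by
        have : (0 : ℝ) < Fintype.card A := by exact_mod_cast Fintype.card_pos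
        positivity
      refine ⟨?_, ?_, ?_⟩
      · simpa [L] using KK_cone _ hc1 _ hc
      · have : (1 : Matrix B B ℂ) + - trA (((2 * Fintype.card A : ℝ)⁻¹) •
            (1 : Matrix (A × B) (A × B) ℂ)) = (2⁻¹ : ℝ) • 1 := by
          rw [trA_smul, ← one_kronecker_one, trA_kron, smul_smul, mul_inv, mul_assoc,
            inv_mul_cancel₀ (by simp), mul_one]
          module
        change (1 : Matrix B B ℂ) + - trA _ ∈ _
        rw [this]
        exact KK_cone _ hc2 _ (by norm_num)
      · change (1 - P) + P * (((2 * Fintype.card A : ℝ)⁻¹) • 1 - (-1) ⊗ₖ (1 : Matrix B B ℂ)) * P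
          ∈ _
        have : (1 - P) + P * (((2 * Fintype.card A : ℝ)⁻¹) • 1
            - (-1 : Matrix A A ℂ) ⊗ₖ (1 : Matrix B B ℂ)) * P
            = 1 + ((2 * Fintype.card A : ℝ)⁻¹) • P := by
          have h : (-1 : Matrix A A ℂ) ⊗ₖ (1 : Matrix B B ℂ) = -1 := by
            rw [show (-1 : Matrix A A ℂ) = (-1 : ℝ) • 1 by simp, smul_kronecker, one_kronecker_one]
            simp
          rw [h, sub_neg_eq_add, mul_add, add_mul, mul_one, hP.2, mul_smul_comm, mul_one,
            smul_mul_assoc, hP.2]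
          abel
        rw [this]
        exact KK_of_posDef (PosDef.one.add_posSemidef (hPpsd.smul hc.le)))
    d
    (by
      rintro ⟨S, E⟩ ⟨h1, h2, h3⟩
      have h1 : E ∈ KK (A × B) := by simpa [L] using h1
      have h2 : 1 - trA E ∈ KK B := by rw [sub_eq_add_neg]; exact h2
      obtain ⟨S', hS', he, E', hE', hE1, hl⟩ := dual_of_strict hP S E h1 h2 h3
      change S.trace.re ≤ d
      rw [he]
      exact hd S' E' hS' hE' hE1 hl)
  obtain ⟨Λ1, r1⟩ := repr_lin (φ ∘ₗ LinearMap.inl ℝ _ _)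
  obtain ⟨Λ2, r2⟩ := repr_lin (φ ∘ₗ LinearMap.inr ℝ _ _ ∘ₗ LinearMap.inl ℝ _ _)
  obtain ⟨Λ3, r3⟩ := repr_lin (φ ∘ₗ LinearMap.inr ℝ _ _ ∘ₗ LinearMap.inr ℝ _ _)
  have r : ∀ a b c, φ (a, b, c) = (Λ1 * a).trace.re + (Λ2 * b).trace.re + (Λ3 * c).trace.re := by
    intro a b c
    rw [← r1, ← r2, ← r3]
    simp only [LinearMap.comp_apply, ← map_add]
    simp
  have hK : ∀ a ∈ KK (A × B), ∀ b ∈ KK B, ∀ c ∈ KK (A × B),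
      0 ≤ (Λ1 * a).trace.re ∧ 0 ≤ (Λ2 * b).trace.re ∧ 0 ≤ (Λ3 * c).trace.re := by
    intro a ha b hb c hc
    have H : ∀ s t u : ℝ, 0 < s → 0 < t → 0 < u →
        0 ≤ s * (Λ1 * a).trace.re + t * (Λ2 * b).trace.re + u * (Λ3 * c).trace.re := by
      intro s t u hs ht hu
      have := hφK (s • a, t • b, u • c) ⟨KK_cone _ ha _ hs, KK_cone _ hb _ ht, KK_cone _ hc _ hu⟩
      rw [r] at this
      simpa [trace_smul] using this
    generalize (Λ1 * a).trace.re = x at *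
    generalize (Λ2 * b).trace.re = y at *
    generalize (Λ3 * c).trace.re = z at *
    have G : ∀ x y z : ℝ, (∀ s t u : ℝ, 0 < s → 0 < t → 0 < u → 0 ≤ s * x + t * y + u * z) →
        0 ≤ x := by
      intro x y z H
      by_contra hc
      push Not at hc
      have h := H ((|y| + |z| + 1) / (-x)) 1 1 (div_pos (by positivity) (by linarith))
        one_pos one_pos
      rw [div_neg, neg_mul, div_mul_cancel₀ _ hc.ne] at h
      linarith [le_abs_self y, le_abs_self z]
    refine ⟨G x y z H, G y x z fun s t u hs ht hu => ?_, G z y x fun s t u hs ht hu => ?_⟩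
    · linarith [H t s u ht hs hu]
    · linarith [H u t s hu ht hs]
  have p1 : Λ1.PosSemidef := psd_of_KK fun k hk => (hK k hk 1 hc2 1 hc1).1
  have p2 : Λ2.PosSemidef := psd_of_KK fun k hk => (hK 1 hc1 k hk 1 hc1).2.1
  have p3 : Λ3.PosSemidef := psd_of_KK fun k hk => (hK 1 hc1 1 hc2 k hk).2.2
  set F := P * Λ3 * P with hFdef
  have hF : F.PosSemidef := by
    have := p3.mul_mul_conjTranspose_same P
    rwa [hP.1.eq] at this
  have tr3 : ∀ X, (Λ3 * (P * X * P)).trace = (F * X).trace := by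
    intro X
    rw [hFdef, ← mul_assoc, trace_mul_comm, ← mul_assoc, ← mul_assoc]
  -- full inequality
  have ineq : ∀ S E, S.trace.re + ((Λ1 * E).trace.re + (Λ2.trace.re - (Λ2 * trA E).trace.re)
      + ((Λ3 * (1 - P)).trace.re + ((F * E).trace.re - (trB F * S).trace.re))) ≤ d := by
    intro S E
    have h := hφ (S, E)
    have h' : ((0, 1, 1 - P) + L (S, E) :
        Matrix (A × B) (A × B) ℂ × Matrix B B ℂ × Matrix (A × B) (A × B) ℂ)
        = (E, 1 - trA E, (1 - P) + P * (E - S ⊗ₖ (1 : Matrix B B ℂ)) * P) := by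
      refine Prod.ext ?_ (Prod.ext ?_ rfl)
      · simp [L]
      · simp [L, sub_eq_add_neg]
    rw [h', r, mul_add Λ3, trace_add, tr3, mul_sub F, trace_sub, trace_trB, mul_sub Λ2, mul_one,
      trace_sub] at h
    simpa [f] using h
  have lin0 : ∀ q c : ℝ, (∀ s : ℝ, s * q + c ≤ d) → q = 0 := by
    intro q c h
    by_contra hq
    have := h ((d - c + 1) / q)
    rw [div_mul_cancel₀ _ hq] at this
    linarith
  have hFB : trB F = 1 := by
    have : 1 - trB F = 0 := by
      apply nondeg
      intro S
      refine lin0 _ (Λ2.trace.re + (Λ3 * (1 - P)).trace.re) fun s => ?_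
      have h := ineq (s • S) 0
      have t0 : trA (0 : Matrix (A × B) (A × B) ℂ) = 0 := by ext; simp [trA]
      simp only [t0, mul_zero, trace_zero, Complex.zero_re, mul_smul_comm, trace_smul,
        Complex.smul_re, smul_eq_mul] at h
      rw [sub_mul, one_mul, trace_sub, Complex.sub_re]
      linarith
    exact (sub_eq_zero.1 this).symm
  have hΛ : Λ1 - (1 : Matrix A A ℂ) ⊗ₖ Λ2 + F = 0 := by
    apply nondeg
    intro E
    refine lin0 _ (Λ2.trace.re + (Λ3 * (1 - P)).trace.re) fun s => ?_
    have h := ineq 0 (s • E)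
    simp only [trA_smul, mul_zero, trace_zero, Complex.zero_re, mul_smul_comm, trace_smul,
      Complex.smul_re, smul_eq_mul] at h
    rw [add_mul, sub_mul, trace_add, trace_sub, trace_trA, Complex.add_re, Complex.sub_re]
    linarith
  refine ⟨Λ2, p2.1, ?_, F, by simpa [loe] using hF, ?_, hFB, ?_⟩
  · have h := ineq 0 0
    have t0 : trA (0 : Matrix (A × B) (A × B) ℂ) = 0 := by ext; simp [trA]
    simp only [t0, mul_zero, trace_zero, Complex.zero_re] at h
    have hQ : (1 - P).PosSemidef := by
      have := posSemidef_self_mul_conjTranspose (1 - P)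
      simpa [hP.1.eq, mul_sub, sub_mul, hP.2] using this
    have := trace_mul_psd p3 hQ
    linarith
  · rw [loe]
    have : (1 : Matrix A A ℂ) ⊗ₖ Λ2 - F = Λ1 := by
      rw [← sub_eq_zero, ← neg_eq_zero, ← hΛ]; abel
    rwa [this]
  · have : (1 - P) * F = 0 := by
      rw [hFdef, sub_mul, one_mul, ← mul_assoc, ← mul_assoc, hP.2, sub_self]
    rw [this, trace_zero]

theorem dual_zero [Nonempty A] {P : Matrix (A × B) (A × B) ℂ} (hP : IsProj P) :
    (0 : ℝ) ∈ { x : ℝ | ∃ S : Matrix A A ℂ, S.IsHermitian ∧ x = S.trace.re ∧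
      ∃ E : Matrix (A × B) (A × B) ℂ, E.PosSemidef ∧ trA E = 1 ∧
        loe (P * (S ⊗ₖ (1 : Matrix B B ℂ) - E) * P) 0 } := by
  have h : ((Fintype.card A : ℝ)⁻¹ • (1 : Matrix (A × B) (A × B) ℂ)).PosSemidef :=
    PosSemidef.one.smul (by positivity)
  refine ⟨0, isHermitian_zero, by simp, _, h, ?_, ?_⟩
  · rw [trA_smul, ← one_kronecker_one, trA_kron, smul_smul, inv_mul_cancel₀ (by simp), one_smul]
  · have := h.mul_mul_conjTranspose_same P
    rw [hP.1.eq] at this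
    rw [loe, zero_kronecker, zero_sub, zero_sub, mul_neg, neg_mul, neg_neg]
    exact this

/-- Strong duality for the one-shot no-signalling assisted simulation cost. -/
theorem sigma_strong_duality [Nonempty A] [Nonempty B]
    (P : Matrix (A × B) (A × B) ℂ) (hP : IsProj P) (hch : SupportsChannel P) :
    SigmaNS P = sSup { x : ℝ | ∃ S : Matrix A A ℂ, S.IsHermitian ∧ x = S.trace.re ∧
      ∃ E : Matrix (A × B) (A × B) ℂ, E.PosSemidef ∧ trA E = 1 ∧
        loe (P * (S ⊗ₖ (1 : Matrix B B ℂ) - E) * P) 0 } := by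
  have hwd : ∀ x ∈ { x : ℝ | ∃ T : Matrix B B ℂ, T.IsHermitian ∧ x = T.trace.re ∧
      ∃ F : Matrix (A × B) (A × B) ℂ, loe 0 F ∧ loe F ((1 : Matrix A A ℂ) ⊗ₖ T) ∧ trB F = 1 ∧
      ((1 - P) * F).trace = 0 },
      ∀ y ∈ { x : ℝ | ∃ S : Matrix A A ℂ, S.IsHermitian ∧ x = S.trace.re ∧
      ∃ E : Matrix (A × B) (A × B) ℂ, E.PosSemidef ∧ trA E = 1 ∧
        loe (P * (S ⊗ₖ (1 : Matrix B B ℂ) - E) * P) 0 }, y ≤ x := by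
    rintro x ⟨T, -, rfl, F, h1, h2, h3, h4⟩ y ⟨S, -, rfl, E, g1, g2, g3⟩
    exact weak_dual hP h1 h2 h3 h4 g1 g2 g3
  obtain ⟨T0, hT0, hF0⟩ := primal_feas hP hch
  have hm0 := hwd _ ⟨T0, hT0, rfl, hF0⟩
  apply le_antisymm
  · obtain ⟨T, hT, hle, hF⟩ := strong_exists hP _ (fun S E hS hE hE1 hl =>
      le_csSup ⟨_, fun y hy => hm0 y hy⟩ ⟨S, hS, rfl, E, hE, hE1, hl⟩)
    exact (csInf_le ⟨0, fun x hx => hwd x hx 0 (dual_zero hP)⟩ ⟨T, hT, rfl, hF⟩).trans hle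
  · exact csSup_le ⟨0, dual_zero hP⟩ fun y hy =>
      le_csInf ⟨_, T0, hT0, rfl, hF0⟩ fun x hx => hwd x hx y hy
end
end

section
/- Let A and B be nonempty finite types and let P be a projection on ℂ^(A×B) such that Tr_B(P) is positive definite. Then the revised semidefinite packing number satisfies Ã(P) = inf { Re(trace T) : T a positive semidefinite B×B matrix with Tr_B(P·(1_A ⊗ T)·P) ≥ 1_A }. (Strong duality between the primal and dual forms of the revised semidefinite packing number.) -/
open Matrix Kronecker BigOperators
open scoped ComplexOrder

noncomputable section

variable {A B : Type*} [Fintype A] [Fintype B] [DecidableEq A] [DecidableEq B]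

/-- Revised semidefinite packing number (primal SDP). -/
def AramTilde (P : Matrix (A × B) (A × B) ℂ) : ℝ :=
  sSup { x : ℝ | ∃ S : Matrix A A ℂ, S.PosSemidef ∧ x = S.trace.re ∧
    loe (trA (P * (S ⊗ₖ (1 : Matrix B B ℂ)) * P)) 1 }


set_option linter.unusedSectionVars false

section helpers

variable {n : Type*} [Fintype n] [DecidableEq n]

lemma h_factor {X : Matrix n n ℂ} (hX : X.PosSemidef) : ∃ M : Matrix n n ℂ, X = Mᴴ * M := by
  open scoped MatrixOrder in
  exact CStarAlgebra.nonneg_iff_eq_star_mul_self.mp (nonneg_iff_posSemidef.mpr hX)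

lemma h_trace_mul_nonneg {S X : Matrix n n ℂ} (hS : S.PosSemidef) (hX : X.PosSemidef) :
    0 ≤ (S * X).trace.re := by
  obtain ⟨M, rfl⟩ := h_factor hX
  rw [← Matrix.mul_assoc, Matrix.trace_mul_comm, ← Matrix.mul_assoc]
  exact (Complex.le_def.mp (hS.mul_mul_conjTranspose_same M).trace_nonneg).1

lemma h_posdef_bound [Nonempty n] {D : Matrix n n ℂ} (hD : D.PosDef) :
    ∃ t : ℝ, 0 ≤ t ∧ ((t : ℂ) • D - 1).PosSemidef := by
  obtain ⟨c, hc0, hc⟩ : ∃ c : ℝ, 0 < c ∧ (D - (c : ℂ) • 1).PosSemidef := by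
    open scoped MatrixOrder in
    have h1 : IsStrictlyPositive D := isStrictlyPositive_iff_posDef.mpr hD
    open scoped MatrixOrder in
    have := (CFC.exists_pos_algebraMap_le_iff (A := Matrix n n ℂ) h1.isSelfAdjoint).2
      fun x hx ↦ h1.spectrum_pos hx
    obtain ⟨c, hc0, hc⟩ := this
    refine ⟨c, hc0, ?_⟩
    have e : (c : ℂ) • (1 : Matrix n n ℂ) = algebraMap ℝ (Matrix n n ℂ) c := by
      rw [Algebra.algebraMap_eq_smul_one]
      ext i j
      simp
    rw [e]
    exact Matrix.le_iff.mp hc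
  refine ⟨c⁻¹, by positivity, ?_⟩
  have := hc.smul (a := ((c⁻¹ : ℝ) : ℂ)) (by exact_mod_cast (by positivity : 0 ≤ c⁻¹))
  convert this using 1
  rw [smul_sub, smul_smul, ← Complex.ofReal_mul, inv_mul_cancel₀ hc0.ne']
  simp

lemma h_quad (S : Matrix n n ℂ) (x : n → ℂ) :
    (S * vecMulVec x (star x)).trace = star x ⬝ᵥ (S *ᵥ x) := by
  rw [Matrix.mul_vecMulVec, Matrix.trace_vecMulVec, dotProduct_comm]

lemma h_psd_of_re {S : Matrix n n ℂ} (hS : S.IsHermitian)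
    (h : ∀ x : n → ℂ, 0 ≤ (star x ⬝ᵥ (S *ᵥ x)).re) : S.PosSemidef := by
  refine PosSemidef.of_dotProduct_mulVec_nonneg hS fun x => ?_
  refine Complex.le_def.mpr ⟨h x, ?_⟩
  have : star (star x ⬝ᵥ (S *ᵥ x)) = star x ⬝ᵥ (S *ᵥ x) := by
    rw [← star_dotProduct_star, star_star, star_mulVec, hS.eq, dotProduct_mulVec]
  have := congrArg Complex.im this
  simp at this ⊢
  linarith

lemma h_riesz (f : Matrix n n ℂ →ₗ[ℝ] ℝ) : ∃ S : Matrix n n ℂ, S.IsHermitian ∧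
    ∀ X : Matrix n n ℂ, X.IsHermitian → (S * X).trace.re = 2 * f X := by
  let S0 : Matrix n n ℂ := Matrix.of fun j i =>
    (f (Matrix.single i j 1) : ℂ) - Complex.I * (f (Matrix.single i j Complex.I) : ℂ)
  have h0 : ∀ X, (S0 * X).trace.re = f X := by
    intro X
    have hs : ∀ i j, Matrix.single i j (X i j) = (X i j).re • Matrix.single i j (1:ℂ)
        + (X i j).im • Matrix.single i j Complex.I := by
      intro i j
      rw [Matrix.smul_single, Matrix.smul_single, ← Matrix.single_add]
      congr 1
      apply Complex.ext <;> simp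
    conv_rhs => rw [Matrix.matrix_eq_sum_single X]
    simp only [hs, map_sum, map_add, map_smul, Matrix.trace, Matrix.diag, Matrix.mul_apply,
      Complex.re_sum, S0, Matrix.of_apply]
    rw [Finset.sum_comm]
    refine Finset.sum_congr rfl fun i _ => Finset.sum_congr rfl fun j _ => ?_
    simp
    ring
  refine ⟨S0 + S0ᴴ, ?_, fun X hX => ?_⟩
  · simp [Matrix.IsHermitian, add_comm]
  · have : (S0ᴴ * X).trace.re = (S0 * X).trace.re := by
      have : S0ᴴ * X = (X * S0)ᴴ := by rw [conjTranspose_mul, hX.eq]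
      rw [this, trace_conjTranspose, trace_mul_comm]
      simp
    rw [add_mul, trace_add, Complex.add_re, this, h0]
    ring

lemma h_closed_psd : IsClosed {X : Matrix n n ℂ | X.PosSemidef} := by
  have : {X : Matrix n n ℂ | X.PosSemidef} =
      {X | Xᴴ = X} ∩ ⋂ x : n → ℂ, {X | 0 ≤ (star x ⬝ᵥ (X *ᵥ x)).re} := by
    ext X
    simp only [Set.mem_inter_iff, Set.mem_iInter, Set.mem_ofPred_eq]
    exact ⟨fun h => ⟨h.1, fun x => (Complex.le_def.mp (h.dotProduct_mulVec_nonneg x)).1⟩,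
      fun h => h_psd_of_re h.1 h.2⟩
  rw [this]
  refine (isClosed_eq (by fun_prop) (by fun_prop)).inter (isClosed_iInter fun x =>
    isClosed_le (by fun_prop) ?_)
  exact Complex.continuous_re.comp (by fun_prop)

lemma h_compact (w : ℝ) : IsCompact {T : Matrix n n ℂ | T.PosSemidef ∧ T.trace.re ≤ w} := by
  have htr : ∀ M : Matrix n n ℂ, (Mᴴ * M).trace.re = ∑ i, ∑ j, ‖M j i‖ ^ 2 := by
    intro M
    simp only [Matrix.trace, Matrix.diag, Matrix.mul_apply, Complex.re_sum, conjTranspose_apply]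
    refine Finset.sum_congr rfl fun i _ => Finset.sum_congr rfl fun j _ => ?_
    rw [← Complex.normSq_eq_norm_sq, Complex.star_def, ← Complex.normSq_eq_conj_mul_self]
    simp
  have him : {T : Matrix n n ℂ | T.PosSemidef ∧ T.trace.re ≤ w} =
      (fun M : Matrix n n ℂ => Mᴴ * M) '' {M | (Mᴴ * M).trace.re ≤ w} := by
    ext T
    constructor
    · rintro ⟨h1, h2⟩
      obtain ⟨M, rfl⟩ := h_factor h1
      exact ⟨M, h2, rfl⟩
    · rintro ⟨M, h, rfl⟩
      exact ⟨posSemidef_conjTranspose_mul_self M, h⟩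
  rw [him]
  refine IsCompact.image ?_ (by fun_prop)
  have hK : IsCompact (Set.univ.pi fun _ : n => Set.univ.pi fun _ : n =>
      Metric.closedBall (0 : ℂ) (Real.sqrt w)) :=
    isCompact_univ_pi fun _ => isCompact_univ_pi fun _ => isCompact_closedBall _ _
  have hcl : IsClosed {M : Matrix n n ℂ | (Mᴴ * M).trace.re ≤ w} :=
    isClosed_le (Complex.continuous_re.comp (by fun_prop)) continuous_const
  refine IsCompact.of_isClosed_subset hK hcl fun M hM => ?_
  intro i _ j _
  simp only [Set.mem_ofPred_eq, htr] at hM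
  rw [mem_closedBall_zero_iff]
  refine Real.le_sqrt_of_sq_le (le_trans ?_ hM)
  exact le_trans (Finset.single_le_sum (f := fun k => ‖M k j‖ ^ 2)
      (fun k _ => by positivity) (Finset.mem_univ i))
    (Finset.single_le_sum (f := fun l => ∑ k, ‖M k l‖ ^ 2)
      (fun k _ => by positivity) (Finset.mem_univ j))

lemma h_convex_psd : Convex ℝ {X : Matrix n n ℂ | X.PosSemidef} := by
  intro x hx y hy a b ha hb _
  exact (PosSemidef.smul hx ha).add (PosSemidef.smul hy hb)

lemma h_lcs : LocallyConvexSpace ℝ (Matrix n n ℂ) :=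
  inferInstanceAs (LocallyConvexSpace ℝ (n → n → ℂ))

/-- abstract duality step -/
lemma h_abstract {m : Type*} [Fintype m] [DecidableEq m]
    (Φ : Matrix n n ℂ → Matrix m m ℂ) (Ψ : Matrix m m ℂ →ₗ[ℝ] Matrix n n ℂ)
    (hΨc : Continuous Ψ)
    (hadj : ∀ S T, (S * Ψ T).trace = (Φ S * T).trace)
    (hΦs : ∀ (c : ℝ) S, Φ (c • S) = c • Φ S)
    (hΦ : ∀ S, S.IsHermitian → (Φ S).IsHermitian)
    (hΨ : ∀ S, S.IsHermitian → (Ψ S).IsHermitian) (w : ℝ) (hw : 0 < w)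
    (hno : ¬ ∃ T : Matrix m m ℂ, T.PosSemidef ∧ T.trace.re ≤ w ∧ (Ψ T - 1).PosSemidef) :
    ∃ S : Matrix n n ℂ, S.PosSemidef ∧ S.trace.re = w ∧ (1 - Φ S).PosSemidef := by
  have := h_lcs (n := n)
  have hcv : Convex ℝ {T : Matrix m m ℂ | T.PosSemidef ∧ T.trace.re ≤ w} := by
    intro x hx y hy a b ha hb hab
    refine ⟨h_convex_psd hx.1 hy.1 ha hb hab, ?_⟩
    have h1 := mul_le_mul_of_nonneg_left hx.2 ha
    have h2 := mul_le_mul_of_nonneg_left hy.2 hb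
    simp only [trace_add, trace_smul, Complex.add_re, Complex.real_smul, Complex.re_ofReal_mul]
    have : a * w + b * w = w := by rw [← add_mul, hab, one_mul]
    linarith
  obtain ⟨f, u, v, h1, huv, h2⟩ := geometric_hahn_banach_compact_closed (E := Matrix n n ℂ)
    (s := Ψ '' {T | T.PosSemidef ∧ T.trace.re ≤ w}) (t := {X | (X - 1).PosSemidef})
    (hcv.linear_image Ψ) ((h_compact w).image hΨc)
    (by
      intro x hx y hy a b ha hb hab
      have := h_convex_psd hx hy ha hb hab
      simp only [Set.mem_ofPred_eq] at this ⊢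
      convert this using 1
      have h1 : (1 : Matrix n n ℂ) = a • 1 + b • 1 := by rw [← add_smul, hab, one_smul]
      conv_lhs => rw [h1]
      simp only [smul_sub]
      abel)
    (h_closed_psd.preimage (f := fun X : Matrix n n ℂ => X - 1) (by fun_prop))
    (by
      rw [Set.disjoint_left]
      rintro _ ⟨T, hT, rfl⟩ h
      exact hno ⟨T, hT.1, hT.2, h⟩)
  have hf0 : ∀ R : Matrix n n ℂ, R.PosSemidef → 0 ≤ f R := by
    intro R hR
    by_contra! hneg
    have hf1 : v < f 1 := h2 1 (by simpa using PosSemidef.zero)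
    have := h2 (1 + ((f 1 - v) / (- f R)) • R) (by
      simp only [Set.mem_ofPred_eq, add_sub_cancel_left]
      exact hR.smul (div_nonneg (by linarith) (by linarith)))
    rw [map_add, map_smul, smul_eq_mul] at this
    have h3 : (f 1 - v) / (- f R) * f R = -(f 1 - v) := by
      field_simp [hneg.ne]
    linarith
  obtain ⟨S, hSH, hS⟩ := h_riesz f.toLinearMap
  simp only [ContinuousLinearMap.coe_coe] at hS
  have hSp : S.PosSemidef := by
    refine h_psd_of_re hSH fun x => ?_
    rw [← h_quad, hS _ (posSemidef_vecMulVec_self_star x).1]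
    have := hf0 _ (posSemidef_vecMulVec_self_star x)
    linarith
  have htr : S.trace.re = 2 * f 1 := by
    rw [← hS 1 isHermitian_one, mul_one]
  have hf1 : v < f 1 := h2 1 (by simpa using PosSemidef.zero)
  have hb : ∀ T : Matrix m m ℂ, T.PosSemidef → T.trace.re ≤ w → (Φ S * T).trace.re < S.trace.re := by
    intro T hT hTw
    rw [← hadj, hS _ (hΨ _ hT.1), htr]
    have := h1 _ ⟨T, ⟨hT, hTw⟩, rfl⟩
    linarith
  have hpos : 0 < S.trace.re := by
    simpa using hb 0 PosSemidef.zero (by simpa using hw.le)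
  set s := S.trace.re with hs
  have hc : 0 ≤ w / s := (div_pos hw hpos).le
  refine ⟨(w / s) • S, hSp.smul hc, ?_, ?_⟩
  · rw [trace_smul, Complex.real_smul, Complex.re_ofReal_mul, ← hs]
    field_simp
  · rw [hΦs]
    have hΦH := hΦ S hSH
    refine h_psd_of_re (isHermitian_one.sub (IsSelfAdjoint.smul (IsSelfAdjoint.all _) hΦH)) fun x => ?_
    rw [sub_mulVec, one_mulVec, smul_mulVec, dotProduct_sub, dotProduct_smul, Complex.sub_re,
      Complex.real_smul, Complex.re_ofReal_mul]
    set q := (star x ⬝ᵥ x).re with hq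
    have hV := posSemidef_vecMulVec_self_star x
    have hVt : (vecMulVec x (star x)).trace.re = q := by
      rw [Matrix.trace_vecMulVec, dotProduct_comm]
    have hq0 : 0 ≤ q := hVt ▸ (Complex.le_def.mp hV.trace_nonneg).1
    rcases hq0.eq_or_lt with h0 | h0
    · have hx : x = 0 := by
        have : star x ⬝ᵥ x = 0 := by
          apply Complex.ext
          · exact h0.symm
          · have := (Complex.le_def.mp hV.trace_nonneg).2
            rw [Matrix.trace_vecMulVec, dotProduct_comm] at this
            exact this.symm
        exact dotProduct_star_self_eq_zero.mp (by first | exact this | (rw [dotProduct_comm]; exact this))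
      subst hx
      simp [← h0]
    · have := hb ((w / q) • vecMulVec x (star x)) (hV.smul (div_pos hw h0).le) (by
        rw [trace_smul, Complex.real_smul, Complex.re_ofReal_mul, hVt]
        field_simp
        exact le_refl _)
      rw [Matrix.mul_smul, trace_smul, Complex.real_smul, Complex.re_ofReal_mul, h_quad] at this
      rw [div_mul_eq_mul_div, div_lt_iff₀ h0] at this
      rw [sub_nonneg, div_mul_eq_mul_div, div_le_iff₀ hpos]
      linarith

end helpers

lemma h_adjA (M : Matrix (A × B) (A × B) ℂ) (T : Matrix B B ℂ) :
    (trA M * T).trace = (M * ((1 : Matrix A A ℂ) ⊗ₖ T)).trace := by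
  simp only [Matrix.trace, Matrix.diag, Matrix.mul_apply, trA, Matrix.of_apply,
    Fintype.sum_prod_type, Matrix.kroneckerMap_apply, Matrix.one_apply, ite_mul, one_mul, zero_mul,
    mul_ite, mul_zero, Finset.sum_mul]
  simp
  rw [Finset.sum_comm' (s := (Finset.univ : Finset A)) (t := fun _ => (Finset.univ : Finset B))
    (t' := Finset.univ) (s' := fun _ => Finset.univ) (by simp)]
  refine Finset.sum_congr rfl fun b _ => ?_
  rw [Finset.sum_comm]

lemma h_adjB (M : Matrix (A × B) (A × B) ℂ) (S : Matrix A A ℂ) :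
    (S * trB M).trace = ((S ⊗ₖ (1 : Matrix B B ℂ)) * M).trace := by
  simp only [Matrix.trace, Matrix.diag, Matrix.mul_apply, trB, Matrix.of_apply,
    Fintype.sum_prod_type, Matrix.kroneckerMap_apply, Matrix.one_apply, ite_mul, one_mul, zero_mul,
    mul_ite, mul_one, mul_zero, Finset.mul_sum]
  simp
  refine Finset.sum_congr rfl fun a _ => ?_
  rw [Finset.sum_comm]

lemma h_adj (P : Matrix (A × B) (A × B) ℂ) (S : Matrix A A ℂ) (T : Matrix B B ℂ) :
    (S * trB (P * ((1 : Matrix A A ℂ) ⊗ₖ T) * P)).trace =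
      (trA (P * (S ⊗ₖ (1 : Matrix B B ℂ)) * P) * T).trace := by
  rw [h_adjA, h_adjB, ← Matrix.mul_assoc, Matrix.trace_mul_comm]
  simp only [Matrix.mul_assoc]

lemma h_trA_herm {M : Matrix (A × B) (A × B) ℂ} (h : M.IsHermitian) : (trA M).IsHermitian := by
  ext b b'
  simp only [conjTranspose_apply, trA, of_apply, star_sum]
  exact Finset.sum_congr rfl fun a _ => h.apply _ _

lemma h_trB_herm {M : Matrix (A × B) (A × B) ℂ} (h : M.IsHermitian) : (trB M).IsHermitian := by
  ext b b'
  simp only [conjTranspose_apply, trB, of_apply, star_sum]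
  exact Finset.sum_congr rfl fun a _ => h.apply _ _

lemma h_conj_herm {P X : Matrix (A × B) (A × B) ℂ} (hP : P.IsHermitian) (h : X.IsHermitian) :
    (P * X * P).IsHermitian := by
  rw [Matrix.IsHermitian, conjTranspose_mul, conjTranspose_mul, hP.eq, h.eq, Matrix.mul_assoc]

lemma h_kron_herm {S : Matrix A A ℂ} {T : Matrix B B ℂ} (hS : S.IsHermitian)
    (hT : T.IsHermitian) : (S ⊗ₖ T).IsHermitian := by
  rw [Matrix.IsHermitian, conjTranspose_kronecker, hS.eq, hT.eq]

lemma h_trA_smul (c : ℝ) (M : Matrix (A × B) (A × B) ℂ) : trA (c • M) = c • trA M := by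
  ext; simp [trA, Finset.mul_sum]

lemma h_trB_smul (c : ℝ) (M : Matrix (A × B) (A × B) ℂ) : trB (c • M) = c • trB M := by
  ext; simp [trB, Finset.mul_sum]

lemma h_trB_add (M N : Matrix (A × B) (A × B) ℂ) : trB (M + N) = trB M + trB N := by
  ext; simp [trB, Finset.sum_add_distrib]

/-- The dual map as a linear map. -/
def hPsi (P : Matrix (A × B) (A × B) ℂ) : Matrix B B ℂ →ₗ[ℝ] Matrix A A ℂ where
  toFun T := trB (P * ((1 : Matrix A A ℂ) ⊗ₖ T) * P)
  map_add' x y := by rw [kronecker_add, mul_add, add_mul, h_trB_add]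
  map_smul' c x := by
    rw [kronecker_smul, Matrix.mul_smul, Matrix.smul_mul, h_trB_smul]; rfl

lemma h_Psi_cont (P : Matrix (A × B) (A × B) ℂ) : Continuous (hPsi P) := by
  change Continuous fun T => trB (P * ((1 : Matrix A A ℂ) ⊗ₖ T) * P)
  refine continuous_matrix fun a a' => ?_
  simp only [trB, of_apply, Matrix.mul_apply, kroneckerMap_apply]
  fun_prop

/-- Strong duality for the revised semidefinite packing number. -/
theorem aramTilde_strong_duality [Nonempty A] [Nonempty B]
    (P : Matrix (A × B) (A × B) ℂ) (hP : IsProj P) (hPD : (trB P).PosDef) :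
    AramTilde P = sInf { x : ℝ | ∃ T : Matrix B B ℂ, T.PosSemidef ∧ x = T.trace.re ∧
      loe 1 (trB (P * ((1 : Matrix A A ℂ) ⊗ₖ T) * P)) } := by
  unfold AramTilde
  set U := { x : ℝ | ∃ S : Matrix A A ℂ, S.PosSemidef ∧ x = S.trace.re ∧
    loe (trA (P * (S ⊗ₖ (1 : Matrix B B ℂ)) * P)) 1 } with hU
  set D := { x : ℝ | ∃ T : Matrix B B ℂ, T.PosSemidef ∧ x = T.trace.re ∧
      loe 1 (trB (P * ((1 : Matrix A A ℂ) ⊗ₖ T) * P)) } with hD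
  have hweak : ∀ x ∈ U, ∀ y ∈ D, x ≤ y := by
    rintro _ ⟨S, hS, rfl, hS1⟩ _ ⟨T, hT, rfl, hT1⟩
    have e1 := h_trace_mul_nonneg hS hT1
    have e2 := h_trace_mul_nonneg hS1 hT
    rw [mul_sub, mul_one, trace_sub, Complex.sub_re, h_adj] at e1
    rw [sub_mul, one_mul, trace_sub, Complex.sub_re] at e2
    linarith
  have h0U : (0 : ℝ) ∈ U := ⟨0, PosSemidef.zero, by simp, by
    have : trA (0 : Matrix (A × B) (A × B) ℂ) = 0 := by ext; simp [trA]
    simpa [loe, this] using PosSemidef.one⟩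
  have hDne : D.Nonempty := by
    obtain ⟨t, ht, h⟩ := h_posdef_bound hPD
    refine ⟨_, t • 1, PosSemidef.one.smul ht, rfl, ?_⟩
    rw [kronecker_smul, Matrix.mul_smul, Matrix.smul_mul, h_trB_smul, one_kronecker_one,
      mul_one, hP.2]
    exact h
  have hUb : BddAbove U := by
    obtain ⟨y, hy⟩ := hDne
    exact ⟨y, fun x hx => hweak x hx y hy⟩
  have hDb : BddBelow D := ⟨0, fun y hy => hweak 0 h0U y hy⟩
  apply le_antisymm
  · exact csSup_le ⟨0, h0U⟩ fun x hx => le_csInf hDne fun y hy => hweak x hx y hy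
  · refine le_of_forall_gt fun w hw => ?_
    obtain ⟨w', hw1, hw2⟩ := exists_between hw
    have hw0 : 0 < w' := lt_of_le_of_lt (le_csSup hUb h0U) hw1
    by_cases hex : ∃ T : Matrix B B ℂ, T.PosSemidef ∧ T.trace.re ≤ w' ∧ (hPsi P T - 1).PosSemidef
    · obtain ⟨T, hT, hTw, hT1⟩ := hex
      exact lt_of_le_of_lt ((csInf_le hDb ⟨T, hT, rfl, hT1⟩).trans hTw) hw2
    · exfalso
      obtain ⟨S, hS, hSw, hS1⟩ := h_abstract
        (fun S => trA (P * (S ⊗ₖ (1 : Matrix B B ℂ)) * P)) (hPsi P) (h_Psi_cont P)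
        (fun S T => h_adj P S T)
        (fun c S => by
          simp only [smul_kronecker, Matrix.mul_smul, Matrix.smul_mul, h_trA_smul])
        (fun S hS => h_trA_herm (h_conj_herm hP.1 (h_kron_herm hS isHermitian_one)))
        (fun S hS => h_trB_herm (h_conj_herm hP.1 (h_kron_herm isHermitian_one hS)))
        w' hw0 hex
      exact absurd (le_csSup hUb ⟨S, hS, hSw.symm, hS1⟩) (not_le.mpr hw1)
end
end
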